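/- arXiv:1507.01782 — 2 statements merged into one kernel-verified Lean document; each statement's English description precedes it below -/
import Mathlib

section
/- For every integer n ≥ 2 and every smooth compactly supported function φ on (0,∞), the Hardy inequality ∫_0^∞ φ'(r)² r^n dr ≥ ((n-1)²/4) ∫_0^∞ φ(r)² r^{n-2} dr holds, and the constant (n-1)²/4 is optimal. -/
open MeasureTheory Real Set

lemma aux_cov (f : ℝ → ℝ) : ∫ r in Ioi (0:ℝ), f r = ∫ t : ℝ, Real.exp t * f (Real.exp t) := by
  have h := integral_image_eq_integral_abs_deriv_smul (s := univ) (f := Real.exp) (f' := Real.exp)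
    MeasurableSet.univ (fun x _ => (Real.hasDerivAt_exp x).hasDerivWithinAt)
    (Real.exp_injective.injOn) f
  rw [image_univ, Real.range_exp] at h
  simpa [abs_of_pos (Real.exp_pos _)] using h

lemma aux_cs {φ : ℝ → ℝ} (c : ℝ) (hc : HasCompactSupport φ) (hs : tsupport φ ⊆ Ioi 0) :
    HasCompactSupport (fun t => Real.exp (c * t) * φ (Real.exp t)) := by
  have hK : IsCompact (Real.log '' tsupport φ) := by
    apply IsCompact.image_of_continuousOn hc
    exact Real.continuousOn_log.mono (fun x hx => (ne_of_gt (hs hx) : x ≠ 0))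
  refine HasCompactSupport.intro hK ?_
  intro x hx
  have : φ (Real.exp x) = 0 := by
    apply image_eq_zero_of_notMem_tsupport
    intro h
    exact hx ⟨_, h, Real.log_exp x⟩
  simp [this]

lemma aux_sq_pos {g : ℝ → ℝ} (hg : Continuous g) (hc : HasCompactSupport g) {x : ℝ}
    (hx : g x ≠ 0) : 0 < ∫ t, (g t)^2 := by
  have hc2 : HasCompactSupport (fun t => (g t)^2) :=
    hc.comp_left (g := fun y : ℝ => y^2) (by simp)
  exact Continuous.integral_pos_of_hasCompactSupport_nonneg_nonzero (x := x) (by fun_prop) hc2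
    (fun t => sq_nonneg _) (pow_ne_zero 2 hx)

lemma aux_B (c : ℝ) {g : ℝ → ℝ} (hg : ContDiff ℝ (⊤ : ℕ∞) g) (hc : HasCompactSupport g) :
    ∫ t, (deriv g t - c * g t)^2 = (∫ t, (deriv g t)^2) + c^2 * ∫ t, (g t)^2 := by
  have hd : Continuous (deriv g) := hg.continuous_deriv (by simp)
  have hgc : Continuous g := hg.continuous
  have hdc : HasCompactSupport (deriv g) := hc.deriv
  have i1 : Integrable (fun t => (deriv g t)^2) :=
    Continuous.integrable_of_hasCompactSupport (by fun_prop)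
      (hdc.comp_left (g := fun y : ℝ => y^2) (by simp))
  have i2 : Integrable (fun t => (g t)^2) :=
    Continuous.integrable_of_hasCompactSupport (by fun_prop)
      (hc.comp_left (g := fun y : ℝ => y^2) (by simp))
  have i3 : Integrable (fun t => 2 * g t * deriv g t) :=
    Continuous.integrable_of_hasCompactSupport (by fun_prop) (hdc.mul_left)
  have h0 : ∫ t, 2 * g t * deriv g t = 0 := by
    refine integral_eq_zero_of_hasDerivAt_of_integrable (f := fun t => (g t)^2) ?_ i3 i2
    intro t
    have h := ((hg.differentiable (by simp)) t).hasDerivAt.pow 2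
    simp only [Nat.cast_ofNat, Nat.add_one_sub_one, pow_one] at h
    exact h
  have e : ∀ t, (deriv g t - c * g t)^2
      = ((deriv g t)^2 + c^2 * (g t)^2) - c * (2 * g t * deriv g t) := fun t => by ring
  simp_rw [e]
  have i4 : Integrable (fun t => (deriv g t)^2 + c^2 * (g t)^2) := i1.add (i2.const_mul _)
  rw [integral_sub i4 (i3.const_mul _), integral_add i1 (i2.const_mul _),
    integral_const_mul, integral_const_mul, h0]
  ring

lemma aux_A (n : ℕ) (hn : 2 ≤ n) {φ g : ℝ → ℝ} (hφ : ContDiff ℝ (⊤ : ℕ∞) φ)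
    (hc : HasCompactSupport φ) (hs : tsupport φ ⊆ Ioi 0)
    (hgdef : g = fun t => Real.exp (((n:ℝ)-1)/2 * t) * φ (Real.exp t)) :
    (∫ r in Ioi (0:ℝ), (deriv φ r)^2 * r^n) = (∫ t, (deriv g t)^2) +
      (((n:ℝ)-1)^2/4) * ∫ t, (g t)^2 ∧
    (∫ r in Ioi (0:ℝ), (φ r)^2 * r^(n-2)) = ∫ t, (g t)^2 := by
  have hg : ContDiff ℝ (⊤ : ℕ∞) g := by
    rw [hgdef]
    exact (Real.contDiff_exp.comp (contDiff_const.mul contDiff_id)).mul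
      (hφ.comp Real.contDiff_exp)
  have hgc : HasCompactSupport g := hgdef ▸ aux_cs _ hc hs
  obtain ⟨m, rfl⟩ : ∃ m, n = m + 2 := ⟨n - 2, by omega⟩
  constructor
  · have hB := aux_B ((((m+2:ℕ):ℝ)-1)/2) hg hgc
    rw [show (((m+2:ℕ):ℝ)-1)^2/4 = ((((m+2:ℕ):ℝ)-1)/2)^2 by ring, ← hB, aux_cov]
    congr 1
    ext t
    have hd : HasDerivAt g (Real.exp ((((m+2:ℕ):ℝ)-1)/2 * t) * ((((m+2:ℕ):ℝ)-1)/2) * φ (Real.exp t)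
        + Real.exp ((((m+2:ℕ):ℝ)-1)/2 * t) * (deriv φ (Real.exp t) * Real.exp t)) t := by
      rw [hgdef]
      have h1 : HasDerivAt (fun t : ℝ => Real.exp ((((m+2:ℕ):ℝ)-1)/2 * t))
          (Real.exp ((((m+2:ℕ):ℝ)-1)/2 * t) * ((((m+2:ℕ):ℝ)-1)/2)) t := by
        have := ((hasDerivAt_id t).const_mul ((((m+2:ℕ):ℝ)-1)/2)).exp
        simpa using this
      have h2 : HasDerivAt (fun t : ℝ => φ (Real.exp t)) (deriv φ (Real.exp t) * Real.exp t) t :=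
        ((hφ.differentiable (by simp)) _).hasDerivAt.comp t (Real.hasDerivAt_exp t)
      exact h1.mul h2
    rw [hd.deriv, hgdef]
    have e : Real.exp ((((m+2:ℕ):ℝ)-1)/2 * t)^2 = Real.exp t ^ (m+1) := by
      rw [← Real.exp_nat_mul, ← Real.exp_nat_mul]
      congr 1
      push_cast
      ring
    calc _ = Real.exp t ^ (m+1) * (deriv φ (Real.exp t) * Real.exp t)^2 := by ring
      _ = _ := by rw [← e]; ring
  · rw [aux_cov]
    congr 1
    ext t
    rw [hgdef]
    have e : Real.exp ((((m+2:ℕ):ℝ)-1)/2 * t)^2 = Real.exp t ^ (m+1) := by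
      rw [← Real.exp_nat_mul, ← Real.exp_nat_mul]
      congr 1
      push_cast
      ring
    calc _ = Real.exp t ^ (m+1) * (φ (Real.exp t))^2 := by
          rw [Nat.add_sub_cancel]; ring
      _ = _ := by rw [← e]; ring

lemma aux_inv (c : ℝ) {g : ℝ → ℝ} (hg : ContDiff ℝ (⊤ : ℕ∞) g) (hc : HasCompactSupport g) :
    ∃ φ : ℝ → ℝ, ContDiff ℝ (⊤ : ℕ∞) φ ∧ HasCompactSupport φ ∧ tsupport φ ⊆ Ioi 0 ∧
      g = fun t => Real.exp (c * t) * φ (Real.exp t) := by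
  have hK : IsCompact (Real.exp '' tsupport g) := IsCompact.image hc Real.continuous_exp
  have hK0 : Real.exp '' tsupport g ⊆ Ioi 0 := by
    rintro _ ⟨x, _, rfl⟩
    exact Real.exp_pos x
  let φ : ℝ → ℝ := fun r => if 0 < r then Real.exp (-c * Real.log r) * g (Real.log r) else 0
  have hz : ∀ r, r ∉ Real.exp '' tsupport g → φ r = 0 := by
    intro r hr
    by_cases h : 0 < r
    · have : g (Real.log r) = 0 := by
        apply image_eq_zero_of_notMem_tsupport
        intro h'
        exact hr ⟨_, h', Real.exp_log h⟩
      simp [φ, this]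
    · simp [φ, h]
  refine ⟨φ, ?_, HasCompactSupport.intro hK hz, ?_, ?_⟩
  · rw [contDiff_iff_contDiffAt]
    intro r
    by_cases h : 0 < r
    · have hl : ContDiffAt ℝ (⊤ : ℕ∞) Real.log r := Real.contDiffAt_log.2 h.ne'
      have : ContDiffAt ℝ (⊤ : ℕ∞) (fun r => Real.exp (-c * Real.log r) * g (Real.log r)) r :=
        ((contDiffAt_const.mul hl).exp).mul (hg.contDiffAt.comp r hl)
      refine this.congr_of_eventuallyEq ?_
      filter_upwards [isOpen_Ioi.mem_nhds h] with x hx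
      have hx' : 0 < x := hx
      simp [φ, hx']
    · refine (contDiffAt_const (c := (0:ℝ))).congr_of_eventuallyEq ?_
      filter_upwards [hK.isClosed.isOpen_compl.mem_nhds (fun hr => h (hK0 hr))] with x hx
      exact hz x hx
  · refine subset_trans (closure_minimal ?_ hK.isClosed) hK0
    intro r hr
    by_contra h
    exact hr (hz r h)
  · ext t
    simp only [φ, Real.exp_pos, if_true, Real.log_exp]
    rw [← mul_assoc, ← Real.exp_add]
    simp

theorem stmt_2 (n : ℕ) (hn : 2 ≤ n) :
    (∀ φ : ℝ → ℝ, ContDiff ℝ (⊤ : ℕ∞) φ → HasCompactSupport φ → tsupport φ ⊆ Ioi 0 →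
      (∫ r in Ioi (0:ℝ), (deriv φ r)^2 * r^n) ≥
        (((n : ℝ) - 1)^2 / 4) * ∫ r in Ioi (0:ℝ), (φ r)^2 * r^(n-2)) ∧
    sInf {q : ℝ | ∃ φ : ℝ → ℝ, ContDiff ℝ (⊤ : ℕ∞) φ ∧ HasCompactSupport φ ∧ tsupport φ ⊆ Ioi 0 ∧
      φ ≠ 0 ∧
      q = (∫ r in Ioi (0:ℝ), (deriv φ r)^2 * r^n) /
          (∫ r in Ioi (0:ℝ), (φ r)^2 * r^(n-2))} = ((n : ℝ) - 1)^2 / 4 := by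
  have key : ∀ φ : ℝ → ℝ, ContDiff ℝ (⊤ : ℕ∞) φ → HasCompactSupport φ → tsupport φ ⊆ Ioi 0 →
      (∫ r in Ioi (0:ℝ), (deriv φ r)^2 * r^n) ≥
        (((n : ℝ) - 1)^2 / 4) * ∫ r in Ioi (0:ℝ), (φ r)^2 * r^(n-2) := by
    intro φ h1 h2 h3
    obtain ⟨e1, e2⟩ := aux_A n hn h1 h2 h3 rfl
    rw [e1, e2]
    have : 0 ≤ ∫ t, (deriv (fun t => Real.exp (((n:ℝ)-1)/2 * t) * φ (Real.exp t)) t)^2 :=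
      integral_nonneg (fun t => sq_nonneg _)
    linarith
  -- near-optimal functions
  have opt : ∀ w, ((n : ℝ) - 1)^2 / 4 < w → ∃ q ∈ {q : ℝ | ∃ φ : ℝ → ℝ,
      ContDiff ℝ (⊤ : ℕ∞) φ ∧ HasCompactSupport φ ∧ tsupport φ ⊆ Ioi 0 ∧ φ ≠ 0 ∧
      q = (∫ r in Ioi (0:ℝ), (deriv φ r)^2 * r^n) /
          (∫ r in Ioi (0:ℝ), (φ r)^2 * r^(n-2))}, q < w := by
    intro w hw
    let b : ContDiffBump (0:ℝ) := ⟨1, 2, by norm_num, by norm_num⟩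
    have hb : ContDiff ℝ (⊤ : ℕ∞) b := b.contDiff
    have hbc : HasCompactSupport b := b.hasCompactSupport
    have hb0 : b 0 ≠ 0 := by
      rw [b.one_of_mem_closedBall (by simp [b])]
      norm_num
    have hB : 0 < ∫ t, (b t)^2 := aux_sq_pos hb.continuous hbc hb0
    set A := ∫ t, (deriv b t)^2 with hA
    set B := ∫ t, (b t)^2 with hBdef
    have hA0 : 0 ≤ A := integral_nonneg (fun t => sq_nonneg _)
    obtain ⟨ε, hε, hεw⟩ : ∃ ε : ℝ, 0 < ε ∧ ε^2 * (A / B) < w - ((n : ℝ) - 1)^2 / 4 := by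
      have hcont : Filter.Tendsto (fun ε : ℝ => ε^2 * (A/B)) (nhdsWithin 0 (Ioi 0)) (nhds 0) := by
        have : Continuous (fun ε : ℝ => ε^2 * (A/B)) := by fun_prop
        have h := this.tendsto 0
        simp only [ne_eq, OfNat.ofNat_ne_zero, not_false_eq_true, zero_pow, zero_mul] at h
        exact h.mono_left nhdsWithin_le_nhds
      have h1 := hcont.eventually (gt_mem_nhds (sub_pos.2 hw))
      obtain ⟨ε, h2, h3⟩ := (h1.and self_mem_nhdsWithin).exists
      exact ⟨ε, h3, h2⟩
    let g : ℝ → ℝ := fun t => b (ε * t)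
    have hg : ContDiff ℝ (⊤ : ℕ∞) g := hb.comp (contDiff_const.mul contDiff_id)
    have hgc : HasCompactSupport g :=
      hbc.comp_homeomorph (Homeomorph.mulLeft₀ ε hε.ne')
    have hgB : ∫ t, (g t)^2 = ε⁻¹ * B := by
      have := Measure.integral_comp_mul_left (fun t => (b t)^2) ε
      simpa [g, abs_of_pos hε] using this
    have hgA : ∫ t, (deriv g t)^2 = ε^2 * (ε⁻¹ * A) := by
      have hd : ∀ t, deriv g t = ε * deriv b (ε * t) := by
        intro t
        have := deriv_comp_mul_left ε b t
        simpa [g] using this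
      simp_rw [hd, mul_pow]
      rw [integral_const_mul]
      have := Measure.integral_comp_mul_left (fun t => (deriv b t)^2) ε
      rw [this]
      simp [abs_of_pos hε, hA]
    obtain ⟨φ, h1, h2, h3, h4⟩ := aux_inv (((n:ℝ)-1)/2) hg hgc
    obtain ⟨e1, e2⟩ := aux_A n hn h1 h2 h3 h4
    refine ⟨_, ⟨φ, h1, h2, h3, ?_, rfl⟩, ?_⟩
    · rintro rfl
      have := congrFun h4 0
      simp [g] at this
      exact hb0 this
    · rw [e1, e2, hgA, hgB]
      have : (ε^2 * (ε⁻¹ * A) + ((n:ℝ)-1)^2/4 * (ε⁻¹ * B)) / (ε⁻¹ * B)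
          = ε^2 * (A/B) + ((n:ℝ)-1)^2/4 := by
        field_simp
      rw [this]
      linarith
  refine ⟨key, ?_⟩
  apply csInf_eq_of_forall_ge_of_forall_gt_exists_lt
  · obtain ⟨q, hq, _⟩ := opt (((n : ℝ) - 1)^2 / 4 + 1) (by linarith)
    exact ⟨q, hq⟩
  · rintro q ⟨φ, h1, h2, h3, h4, rfl⟩
    obtain ⟨e1, e2⟩ := aux_A n hn h1 h2 h3 rfl
    obtain ⟨x, hx⟩ := Function.ne_iff.1 h4
    have hx0 : 0 < x := h3 (subset_tsupport φ hx)
    have hpos : 0 < ∫ r in Ioi (0:ℝ), (φ r)^2 * r^(n-2) := by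
      rw [e2]
      refine aux_sq_pos (x := Real.log x) ?_ (aux_cs _ h2 h3) ?_
      · have := h1.continuous
        fun_prop
      · rw [Real.exp_log hx0]
        exact mul_ne_zero (Real.exp_pos _).ne' hx
    rw [le_div_iff₀ hpos]
    exact key φ h1 h2 h3
  · exact opt
end

section
/- For every integer n ≥ 2, the infimum over nonzero smooth compactly supported functions φ on (0,∞) of the quotient (∫_0^∞ φ'(r)² sinh(r)^n dr) / (∫_0^∞ φ(r)² sinh(r)^{n-2} dr) equals (n-1)²/4. -/
open MeasureTheory Real Set

lemma aux_lower (n : ℕ) (hn : 2 ≤ n) (φ : ℝ → ℝ) (h1 : ContDiff ℝ (⊤ : ℕ∞) φ)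
    (h2 : HasCompactSupport φ) (h3 : tsupport φ ⊆ Ioi 0) :
    ((n : ℝ) - 1)^2 / 4 * (∫ r in Ioi (0:ℝ), (φ r)^2 * (Real.sinh r)^(n-2)) ≤
      ∫ r in Ioi (0:ℝ), (deriv φ r)^2 * (Real.sinh r)^n := by
  obtain ⟨m, rfl⟩ : ∃ m, n = m + 2 := ⟨n - 2, by omega⟩
  simp only [Nat.add_sub_cancel]
  have hz : ∀ x, x ∉ Ioi (0:ℝ) → φ x = 0 := fun x hx =>
    image_eq_zero_of_notMem_tsupport (fun h => hx (h3 h))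
  have hz' : ∀ x, x ∉ Ioi (0:ℝ) → deriv φ x = 0 := fun x hx =>
    image_eq_zero_of_notMem_tsupport (fun h => hx (h3 (tsupport_deriv_subset (𝕜 := ℝ) h)))
  rw [setIntegral_eq_integral_of_forall_compl_eq_zero (fun x hx => by simp [hz x hx]),
    setIntegral_eq_integral_of_forall_compl_eq_zero (fun x hx => by simp [hz' x hx])]
  have hc : Continuous φ := h1.continuous
  have hd : Differentiable ℝ φ := h1.differentiable (by simp)
  have hc' : Continuous (deriv φ) := h1.continuous_deriv (by simp)
  have i1 : Integrable (fun r => (φ r)^2 * (Real.sinh r)^m) :=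
    Continuous.integrable_of_hasCompactSupport (by fun_prop)
      (h2.mono (fun x hx h => hx (by simp [h])))
  have i2 : Integrable (fun r => (deriv φ r)^2 * (Real.sinh r)^(m+2)) :=
    Continuous.integrable_of_hasCompactSupport (by fun_prop)
      (h2.deriv.mono (fun x hx h => hx (by simp [h])))
  have i3 : Integrable (fun r => (φ r)^2 * (Real.sinh r)^(m+1)) :=
    Continuous.integrable_of_hasCompactSupport (by fun_prop)
      (h2.mono (fun x hx h => hx (by simp [h])))
  have i4 : Integrable (fun r => 2 * φ r * deriv φ r * (Real.sinh r)^(m+1)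
      + (φ r)^2 * ((m+1 : ℝ) * (Real.sinh r)^m * Real.cosh r)) :=
    Continuous.integrable_of_hasCompactSupport (by fun_prop)
      (h2.mono (fun x hx h => hx (by simp [h])))
  have hI : ∫ r, (2 * φ r * deriv φ r * (Real.sinh r)^(m+1)
      + (φ r)^2 * ((m+1 : ℝ) * (Real.sinh r)^m * Real.cosh r)) = 0 := by
    refine integral_eq_zero_of_hasDerivAt_of_integrable
      (f := fun r => (φ r)^2 * (Real.sinh r)^(m+1)) (fun x => ?_) i4 i3
    have := ((hd x).hasDerivAt.fun_pow 2).fun_mul ((Real.hasDerivAt_sinh x).fun_pow (m+1))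
    refine this.congr_deriv ?_
    simp only [Nat.add_sub_cancel]
    push_cast
    ring
  have key : ∫ r, ((((m+2:ℕ) : ℝ) - 1)^2 / 4 * ((φ r)^2 * (Real.sinh r)^m) -
      (m+1:ℝ)/2 * (2 * φ r * deriv φ r * (Real.sinh r)^(m+1)
      + (φ r)^2 * ((m+1 : ℝ) * (Real.sinh r)^m * Real.cosh r)))
      ≤ ∫ r, (deriv φ r)^2 * (Real.sinh r)^(m+2) := by
    refine integral_mono ((i1.const_mul _).sub (i4.const_mul _)) i2 (fun r => ?_)
    simp only
    by_cases hr : r ∈ Ioi (0:ℝ)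
    · have hs : 0 < Real.sinh r := Real.sinh_pos_iff.2 hr
      have hch := Real.one_le_cosh r
      have e : (deriv φ r)^2 * (Real.sinh r)^(m+2) - ((((m+2:ℕ) : ℝ) - 1)^2 / 4 * ((φ r)^2 * (Real.sinh r)^m) -
      (m+1:ℝ)/2 * (2 * φ r * deriv φ r * (Real.sinh r)^(m+1)
      + (φ r)^2 * ((m+1 : ℝ) * (Real.sinh r)^m * Real.cosh r))) =
        (Real.sinh r)^m * ((deriv φ r * Real.sinh r + (m+1:ℝ)/2 * φ r)^2
          + (m+1:ℝ)^2/2 * (φ r)^2 * (Real.cosh r - 1)) := by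
        push_cast; ring
      have : 0 ≤ (Real.sinh r)^m * ((deriv φ r * Real.sinh r + (m+1:ℝ)/2 * φ r)^2
          + (m+1:ℝ)^2/2 * (φ r)^2 * (Real.cosh r - 1)) := by
        have : 0 ≤ Real.cosh r - 1 := by linarith
        positivity
      linarith
    · simp [hz r hr, hz' r hr]
  rw [integral_sub (i1.const_mul _) (i4.const_mul _), integral_const_mul, integral_const_mul, hI] at key
  linarith

lemma aux_subst (g : ℝ → ℝ) : ∫ r in Ioi (0:ℝ), g r = ∫ t, Real.exp t * g (Real.exp t) := by
  have := integral_image_eq_integral_abs_deriv_smul (s := univ) (f := Real.exp) (f' := Real.exp)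
    MeasurableSet.univ (fun x _ => (Real.hasDerivAt_exp x).hasDerivWithinAt)
    Real.exp_injective.injOn g
  rw [image_univ, Real.range_exp] at this
  simpa [abs_of_pos (Real.exp_pos _)] using this

/-- Transplanted test function. -/
noncomputable def tst (a : ℝ) (ψ : ℝ → ℝ) (r : ℝ) : ℝ :=
  if 0 < r then Real.exp (-a * Real.log r) * ψ (Real.log r) else 0

lemma tst_pos {a : ℝ} {ψ : ℝ → ℝ} {r : ℝ} (hr : 0 < r) :
    tst a ψ r = Real.exp (-a * Real.log r) * ψ (Real.log r) := by simp [tst, hr]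

lemma tst_ev {a : ℝ} {ψ : ℝ → ℝ} {r : ℝ} (hr : 0 < r) :
    tst a ψ =ᶠ[nhds r] fun r => Real.exp (-a * Real.log r) * ψ (Real.log r) := by
  filter_upwards [Ioi_mem_nhds hr] with x hx using tst_pos hx

lemma tst_supp {a : ℝ} {ψ : ℝ → ℝ} {A B : ℝ} (hs : ∀ t, t ∉ Icc A B → ψ t = 0) :
    tsupport (tst a ψ) ⊆ Icc (Real.exp A) (Real.exp B) := by
  refine closure_minimal (fun r hr => ?_) isClosed_Icc
  by_cases h : 0 < r
  · by_contra hc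
    apply hr
    rw [tst_pos h, hs, mul_zero]
    rintro ⟨h1, h2⟩
    exact hc ⟨(Real.le_log_iff_exp_le h).1 h1, (Real.log_le_iff_le_exp h).1 h2⟩
  · exact absurd (by simp [tst, h]) hr

lemma tst_smooth {a : ℝ} {ψ : ℝ → ℝ} {A B : ℝ} (hψ : ContDiff ℝ (⊤ : ℕ∞) ψ)
    (hs : ∀ t, t ∉ Icc A B → ψ t = 0) : ContDiff ℝ (⊤ : ℕ∞) (tst a ψ) := by
  rw [contDiff_iff_contDiffAt]
  intro r
  by_cases h : 0 < r
  · have hl : ContDiffAt ℝ (⊤ : ℕ∞) Real.log r := Real.contDiffAt_log.2 h.ne'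
    refine ContDiffAt.congr_of_eventuallyEq ?_ (tst_ev h)
    exact ((contDiffAt_const.mul hl).exp).mul (hψ.contDiffAt.comp r hl)
  · have : r ∉ tsupport (tst a ψ) := fun hr => by
      have := (tst_supp hs hr).1
      have := Real.exp_pos A
      linarith
    exact (contDiffAt_const (c := (0:ℝ))).congr_of_eventuallyEq
      (notMem_tsupport_iff_eventuallyEq.1 this)

lemma tst_exp (a : ℝ) (ψ : ℝ → ℝ) (t : ℝ) :
    tst a ψ (Real.exp t) = Real.exp (-a * t) * ψ t := by
  rw [tst_pos (Real.exp_pos t), Real.log_exp]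

lemma tst_deriv_exp (a : ℝ) (ψ : ℝ → ℝ) (hψ : Differentiable ℝ ψ) (t : ℝ) :
    deriv (tst a ψ) (Real.exp t) = Real.exp (-a * t) * Real.exp (-t) * (deriv ψ t - a * ψ t) := by
  rw [(tst_ev (Real.exp_pos t)).deriv_eq]
  have hl := Real.hasDerivAt_log (Real.exp_pos t).ne'
  have h2 : HasDerivAt ψ (deriv ψ t) (Real.log (Real.exp t)) := by
    rw [Real.log_exp]; exact (hψ t).hasDerivAt
  have := ((hl.const_mul (-a)).exp).mul (h2.comp _ hl)
  refine this.deriv.trans ?_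
  simp only [Function.comp, Real.log_exp, Real.exp_neg]
  ring

lemma sinh_ge {x : ℝ} (hx : 0 < x) : 1 ≤ Real.sinh x / x := by
  rw [le_div_iff₀ hx, one_mul]
  exact Real.self_le_sinh_iff.2 hx.le

lemma sinh_le {x d : ℝ} (hx : 0 < x) (hd : x ≤ d) : Real.sinh x / x ≤ Real.cosh d := by
  have h1 : Real.sinh x ≤ x * Real.cosh x := by
    have hm : MonotoneOn (fun y => y * Real.cosh y - Real.sinh y) (Ici 0) := by
      refine monotoneOn_of_deriv_nonneg (convex_Ici 0) (by fun_prop) (by fun_prop) ?_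
      intro y hy
      rw [interior_Ici] at hy
      have hh : HasDerivAt (fun y => y * Real.cosh y - Real.sinh y)
        (1 * Real.cosh y + y * Real.sinh y - Real.cosh y) y :=
        ((hasDerivAt_id y).mul (Real.hasDerivAt_cosh y)).sub (Real.hasDerivAt_sinh y)
      rw [hh.deriv]
      have := mul_pos hy (Real.sinh_pos_iff.2 hy)
      linarith
    have := hm (mem_Ici.2 le_rfl) (mem_Ici.2 hx.le) hx.le
    simp at this
    linarith
  have h2 : Real.cosh x ≤ Real.cosh d := by
    rw [Real.cosh_le_cosh, abs_of_pos hx, abs_of_pos (hx.trans_le hd)]; exact hd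
  rw [div_le_iff₀ hx]
  nlinarith

lemma aux_upper (m : ℕ) (ψ : ℝ → ℝ) (A B : ℝ) (hψ : ContDiff ℝ (⊤ : ℕ∞) ψ)
    (hs : ∀ t, t ∉ Icc A B → ψ t = 0) (h0 : 0 < ∫ t, (ψ t)^2) :
    ∃ φ : ℝ → ℝ, ContDiff ℝ (⊤ : ℕ∞) φ ∧ HasCompactSupport φ ∧ tsupport φ ⊆ Ioi 0 ∧
      φ ≠ 0 ∧ (∫ r in Ioi (0:ℝ), (deriv φ r)^2 * (Real.sinh r)^(m+2)) /
          (∫ r in Ioi (0:ℝ), (φ r)^2 * (Real.sinh r)^m) ≤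
        Real.cosh (Real.exp B) ^ (m+2) * (((m:ℝ)+1)^2/4 + (∫ t, (deriv ψ t)^2) / ∫ t, (ψ t)^2) := by
  set a : ℝ := ((m:ℝ)+1)/2 with ha
  have hsp := tst_supp (a := a) hs
  have hcs : HasCompactSupport ψ := HasCompactSupport.intro isCompact_Icc (fun t ht => hs t ht)
  have hc : Continuous ψ := hψ.continuous
  have hd : Differentiable ℝ ψ := hψ.differentiable (by simp)
  have hc' : Continuous (deriv ψ) := hψ.continuous_deriv (by simp)
  have hts : tsupport ψ ⊆ Icc A B :=
    closure_minimal (fun t ht => by by_contra h; exact ht (hs t h)) isClosed_Icc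
  have hs' : ∀ t, t ∉ Icc A B → deriv ψ t = 0 := fun t ht =>
    image_eq_zero_of_notMem_tsupport (fun h => ht (hts (tsupport_deriv_subset (𝕜 := ℝ) h)))
  have hquot : Continuous fun t => Real.sinh (Real.exp t) / Real.exp t := by
    refine Continuous.div (by fun_prop) (by fun_prop) (fun t => (Real.exp_pos t).ne')
  have i1 : Integrable (fun t => (ψ t)^2) :=
    Continuous.integrable_of_hasCompactSupport (by fun_prop)
      (hcs.mono (fun x hx h => hx (by simp [h])))
  have i2 : Integrable (fun t => (deriv ψ t)^2) :=
    Continuous.integrable_of_hasCompactSupport (by fun_prop)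
      (hcs.deriv.mono (fun x hx h => hx (by simp [h])))
  have i3 : Integrable (fun t => 2 * ψ t * deriv ψ t) :=
    Continuous.integrable_of_hasCompactSupport (by fun_prop)
      (hcs.mono (fun x hx h => hx (by simp [h])))
  have i4 : Integrable (fun t => (ψ t)^2 * (Real.sinh (Real.exp t) / Real.exp t)^m) :=
    Continuous.integrable_of_hasCompactSupport (by fun_prop)
      (hcs.mono (fun x hx h => hx (by simp [h])))
  have i5 : Integrable (fun t => (deriv ψ t - a * ψ t)^2 *
      (Real.sinh (Real.exp t) / Real.exp t)^(m+2)) :=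
    Continuous.integrable_of_hasCompactSupport (by fun_prop)
      (HasCompactSupport.intro (isCompact_Icc (a := A) (b := B))
        (fun t ht => by simp [hs t ht, hs' t ht]))
  have i6 : Integrable (fun t => (deriv ψ t)^2 - a * (2 * ψ t * deriv ψ t) + a^2 * (ψ t)^2) :=
    (i2.sub (i3.const_mul a)).add (i1.const_mul _)
  have hI : ∫ t, 2 * ψ t * deriv ψ t = 0 := by
    refine integral_eq_zero_of_hasDerivAt_of_integrable (f := fun r => (ψ r)^2) (fun x => ?_) i3 i1
    refine ((hd x).hasDerivAt.fun_pow 2).congr_deriv ?_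
    push_cast
    ring
  have hJ : ∫ t, ((deriv ψ t)^2 - a * (2 * ψ t * deriv ψ t) + a^2 * (ψ t)^2)
      = (∫ t, (deriv ψ t)^2) + a^2 * ∫ t, (ψ t)^2 := by
    have i7 : Integrable (fun t => (deriv ψ t)^2 - a * (2 * ψ t * deriv ψ t)) :=
      i2.sub (i3.const_mul a)
    rw [integral_add i7 (i1.const_mul _), integral_sub i2 (i3.const_mul a),
      integral_const_mul, integral_const_mul, hI]
    ring
  have hE : ∀ t, Real.exp (-a*t)^2 * Real.exp t ^ (m+1) = 1 := by
    intro t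
    rw [← Real.exp_nat_mul, ← Real.exp_nat_mul, ← Real.exp_add, Real.exp_eq_one_iff, ha]
    push_cast; ring
  refine ⟨tst a ψ, tst_smooth hψ hs, HasCompactSupport.of_support_subset_isCompact
    (isCompact_Icc (a := Real.exp A) (b := Real.exp B)) (subset_closure.trans hsp),
    fun r hr => (Real.exp_pos A).trans_le (hsp hr).1, ?_, ?_⟩
  · intro hz
    have : ∀ t, ψ t = 0 := fun t => by
      have := tst_exp a ψ t
      rw [hz] at this
      simpa [(Real.exp_pos _).ne'] using this.symm
    simp [this] at h0
  have hD : ∫ r in Ioi (0:ℝ), (tst a ψ r)^2 * (Real.sinh r)^m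
      = ∫ t, (ψ t)^2 * (Real.sinh (Real.exp t) / Real.exp t)^m := by
    rw [aux_subst]
    congr 1; ext t
    rw [tst_exp, div_pow]
    have := (Real.exp_pos t).ne'
    have h := hE t
    generalize Real.sinh (Real.exp t) = s
    generalize Real.exp (-a * t) = E at h ⊢
    generalize Real.exp t = x at this h ⊢
    field_simp
    linear_combination (ψ t)^2 * s ^ m * h
  have hN : ∫ r in Ioi (0:ℝ), (deriv (tst a ψ) r)^2 * (Real.sinh r)^(m+2)
      = ∫ t, (deriv ψ t - a * ψ t)^2 * (Real.sinh (Real.exp t) / Real.exp t)^(m+2) := by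
    rw [aux_subst]
    congr 1; ext t
    rw [tst_deriv_exp _ _ hd, div_pow, Real.exp_neg t]
    have := (Real.exp_pos t).ne'
    have h := hE t
    generalize Real.sinh (Real.exp t) = s
    generalize Real.exp (-a * t) = E at h ⊢
    generalize Real.exp t = x at this h ⊢
    field_simp
    linear_combination (deriv ψ t - a * ψ t)^2 * s ^ (m+2) * x * h
  rw [hD, hN]
  have hDge : ∫ t, (ψ t)^2 ≤ ∫ t, (ψ t)^2 * (Real.sinh (Real.exp t) / Real.exp t)^m := by
    refine integral_mono i1 i4 (fun t => ?_)
    exact le_mul_of_one_le_right (sq_nonneg _) (one_le_pow₀ (sinh_ge (Real.exp_pos t)))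
  have hNle : ∫ t, (deriv ψ t - a * ψ t)^2 * (Real.sinh (Real.exp t) / Real.exp t)^(m+2) ≤
      Real.cosh (Real.exp B) ^ (m+2) * ((∫ t, (deriv ψ t)^2) + a^2 * ∫ t, (ψ t)^2) := by
    rw [← hJ, ← integral_const_mul]
    refine integral_mono i5 (i6.const_mul _) (fun t => ?_)
    simp only
    by_cases ht : t ∈ Icc A B
    · have h1 := sinh_le (Real.exp_pos t) (Real.exp_le_exp.2 ht.2)
      have h2 := sinh_ge (Real.exp_pos t)
      have h3 := pow_le_pow_left₀ (by linarith) h1 (m+2)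
      calc _ ≤ (deriv ψ t - a * ψ t)^2 * Real.cosh (Real.exp B) ^ (m+2) :=
            mul_le_mul_of_nonneg_left h3 (sq_nonneg _)
        _ = _ := by ring
    · simp [hs t ht, hs' t ht]
  have hP : 0 ≤ ∫ t, (deriv ψ t)^2 := integral_nonneg (fun t => sq_nonneg _)
  have hcp := Real.cosh_pos (Real.exp B)
  calc _ ≤ (Real.cosh (Real.exp B) ^ (m+2) * ((∫ t, (deriv ψ t)^2) + a^2 * ∫ t, (ψ t)^2)) /
        ∫ t, (ψ t)^2 := div_le_div₀ (by positivity) hNle h0 hDge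
    _ = _ := by rw [ha]; field_simp; ring

lemma aux_seq : ∃ C : ℝ, ∀ L : ℝ, 0 < L → ∃ ψ : ℝ → ℝ, ContDiff ℝ (⊤ : ℕ∞) ψ ∧
    (∀ t, t ∉ Icc (-(5*L)) (-L) → ψ t = 0) ∧ 0 < ∫ t, (ψ t)^2 ∧
    (∫ t, (deriv ψ t)^2) / (∫ t, (ψ t)^2) = C * (L⁻¹)^2 := by
  let χ : ContDiffBump (0:ℝ) := ⟨1, 2, by norm_num, by norm_num⟩
  have hχ : ContDiff ℝ (⊤ : ℕ∞) χ := χ.contDiff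
  have hp : 0 < ∫ t, (χ t)^2 := by
    refine Continuous.integral_pos_of_hasCompactSupport_nonneg_nonzero (x := 0)
      (χ.continuous.pow 2) (χ.hasCompactSupport.mono (fun x hx h => hx (by simp [h])))
      (fun x => sq_nonneg _) ?_
    have : χ 0 = 1 := χ.one_of_mem_closedBall (by simp [χ])
    simp [this]
  refine ⟨(∫ t, (deriv χ t)^2) / ∫ t, (χ t)^2, fun L hL => ?_⟩
  have e1 : ∀ g : ℝ → ℝ, ∫ t, g (L⁻¹ * (t + 3*L)) = L * ∫ t, g t := by
    intro g
    rw [integral_add_right_eq_self (fun t => g (L⁻¹ * t)) (3*L), Measure.integral_comp_mul_left]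
    simp [abs_of_pos hL]
  have hdv : ∀ t, deriv (fun t => χ (L⁻¹ * (t + 3*L))) t = L⁻¹ * deriv χ (L⁻¹ * (t + 3*L)) := by
    intro t
    have h1 : HasDerivAt χ (deriv χ (L⁻¹ * (t + 3*L))) (L⁻¹ * (t + 3*L)) :=
      ((hχ.differentiable (by simp)) _).hasDerivAt
    have h2 : HasDerivAt (fun t => L⁻¹ * (t + 3*L)) (L⁻¹ * 1) t :=
      ((hasDerivAt_id t).add_const (3*L)).const_mul L⁻¹
    refine (h1.comp t h2).deriv.trans ?_
    ring
  refine ⟨fun t => χ (L⁻¹ * (t + 3*L)), hχ.comp (by fun_prop), fun t ht => ?_, ?_, ?_⟩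
  · apply χ.zero_of_le_dist
    change 2 ≤ _
    rw [Real.dist_eq, sub_zero, abs_mul, abs_of_pos (inv_pos.2 hL), inv_mul_eq_div,
      le_div_iff₀ hL, le_abs]
    by_contra hc
    push Not at hc
    exact ht ⟨by linarith, by linarith⟩
  · rw [e1 (fun t => (χ t)^2)]; positivity
  · simp only [hdv]
    rw [e1 (fun t => (χ t)^2), e1 (fun t => (L⁻¹ * deriv χ t)^2)]
    simp only [mul_pow]
    rw [integral_const_mul]
    field_simp

theorem stmt_3 (n : ℕ) (hn : 2 ≤ n) :
    sInf {q : ℝ | ∃ φ : ℝ → ℝ, ContDiff ℝ (⊤ : ℕ∞) φ ∧ HasCompactSupport φ ∧ tsupport φ ⊆ Ioi 0 ∧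
      φ ≠ 0 ∧
      q = (∫ r in Ioi (0:ℝ), (deriv φ r)^2 * (Real.sinh r)^n) /
          (∫ r in Ioi (0:ℝ), (φ r)^2 * (Real.sinh r)^(n-2))} = ((n : ℝ) - 1)^2 / 4 := by
  obtain ⟨C, hC⟩ := aux_seq
  have hlow : ∀ q ∈ {q : ℝ | ∃ φ : ℝ → ℝ, ContDiff ℝ (⊤ : ℕ∞) φ ∧ HasCompactSupport φ ∧
      tsupport φ ⊆ Ioi 0 ∧ φ ≠ 0 ∧
      q = (∫ r in Ioi (0:ℝ), (deriv φ r)^2 * (Real.sinh r)^n) /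
          (∫ r in Ioi (0:ℝ), (φ r)^2 * (Real.sinh r)^(n-2))}, ((n : ℝ) - 1)^2 / 4 ≤ q := by
    rintro q ⟨φ, h1, h2, h3, h4, rfl⟩
    have hpos : 0 < ∫ r in Ioi (0:ℝ), (φ r)^2 * (Real.sinh r)^(n-2) := by
      have hz : ∀ x, x ∉ Ioi (0:ℝ) → φ x = 0 := fun x hx =>
        image_eq_zero_of_notMem_tsupport (fun h => hx (h3 h))
      rw [setIntegral_eq_integral_of_forall_compl_eq_zero (fun x hx => by simp [hz x hx])]
      obtain ⟨x, hx⟩ := Function.ne_iff.1 h4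
      have hc := h1.continuous
      refine Continuous.integral_pos_of_hasCompactSupport_nonneg_nonzero (x := x) (by fun_prop)
        (h2.mono (fun x hx h => hx (by simp [h]))) (fun y => ?_) ?_
      · by_cases hy : y ∈ Ioi (0:ℝ)
        · have := Real.sinh_pos_iff.2 hy
          simp only [Pi.zero_apply]
          positivity
        · simp [hz y hy]
      · have hx0 : 0 < x := by
          by_contra h
          exact hx (hz x h)
        have := Real.sinh_pos_iff.2 hx0
        exact mul_ne_zero (pow_ne_zero _ hx) (pow_ne_zero _ this.ne')
    rw [le_div_iff₀ hpos]
    exact aux_lower n hn φ h1 h2 h3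
  obtain ⟨m, rfl⟩ : ∃ m, n = m + 2 := ⟨n - 2, by omega⟩
  have hup : ∀ L : ℝ, 0 < L → ∃ q ∈ {q : ℝ | ∃ φ : ℝ → ℝ, ContDiff ℝ (⊤ : ℕ∞) φ ∧
      HasCompactSupport φ ∧ tsupport φ ⊆ Ioi 0 ∧ φ ≠ 0 ∧
      q = (∫ r in Ioi (0:ℝ), (deriv φ r)^2 * (Real.sinh r)^(m+2)) /
          (∫ r in Ioi (0:ℝ), (φ r)^2 * (Real.sinh r)^(m+2-2))},
      q ≤ Real.cosh (Real.exp (-L)) ^ (m+2) * (((m:ℝ)+1)^2/4 + C * (L⁻¹)^2) := by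
    intro L hL
    obtain ⟨ψ, p1, p2, p3, p4⟩ := hC L hL
    obtain ⟨φ, h1, h2, h3, h4, h5⟩ := aux_upper m ψ _ _ p1 p2 p3
    rw [p4] at h5
    exact ⟨_, ⟨φ, h1, h2, h3, h4, rfl⟩, h5⟩
  apply le_antisymm
  · have hlim : Filter.Tendsto (fun L : ℝ => Real.cosh (Real.exp (-L)) ^ (m+2) *
        (((m:ℝ)+1)^2/4 + C * (L⁻¹)^2)) Filter.atTop (nhds ((((m+2:ℕ):ℝ) - 1)^2/4)) := by
      have t1 : Filter.Tendsto (fun L : ℝ => Real.cosh (Real.exp (-L)) ^ (m+2)) Filter.atTop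
          (nhds (Real.cosh 0 ^ (m+2))) :=
        ((Real.continuous_cosh.tendsto 0).comp Real.tendsto_exp_neg_atTop_nhds_zero).pow _
      have t2 : Filter.Tendsto (fun L : ℝ => ((m:ℝ)+1)^2/4 + C * (L⁻¹)^2) Filter.atTop
          (nhds (((m:ℝ)+1)^2/4 + C * 0^2)) :=
        ((tendsto_inv_atTop_zero.pow 2).const_mul C).const_add _
      convert t1.mul t2 using 2
      rw [Real.cosh_zero]
      push_cast
      ring
    refine ge_of_tendsto hlim ?_
    filter_upwards [Filter.eventually_gt_atTop 0] with L hL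
    obtain ⟨q, hq, hle⟩ := hup L hL
    exact (csInf_le ⟨_, hlow⟩ hq).trans hle
  · obtain ⟨q, hq, _⟩ := hup 1 one_pos
    exact le_csInf ⟨q, hq⟩ hlow
end
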